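/- Let ε ~ N(0, σ²I_{n×n}), let h : ℝ^p → [0,+∞] be convex, proper, with the minimization problem defining β̂ admitting a solution for all inputs, and assume the infimum t_c = inf{‖X(β−β*)‖ : h(β) < +∞} is attained. Let t_f be the unique maximizer of f(t) = E[F(t)], and let m be the median of ‖X(β̂−β*)‖. Then |√t_f − √m| ≤ √(21σ/2) ≤ 3.25·√σ, and |√t_f − √(E‖X(β̂−β*)‖)| ≤ √σ·(√(21/2) + (π/2)^{1/4}) ≤ 4.40·√σ. -/

import Mathlib

open MeasureTheory ProbabilityTheory
open scoped ENNReal NNReal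

/-- Euclidean norm of a vector in `ℝ^k`. -/
noncomputable def l2norm {k : ℕ} (v : Fin k → ℝ) : ℝ := Real.sqrt (∑ i, (v i) ^ 2)

/-- Euclidean inner product on `ℝ^k`. -/
noncomputable def dotp {k : ℕ} (u v : Fin k → ℝ) : ℝ := ∑ i, u i * v i

/-- The function `F(t) = sup_{β : ‖X(β-β*)‖ ≤ t} (εᵀX(β-β*) - h(β)) - t²/2`,
with values in `EReal` (the sup over the empty set is `⊥ = -∞`). -/
noncomputable def Fval {n p : ℕ} (X : Matrix (Fin n) (Fin p) ℝ) (bs : Fin p → ℝ)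
    (h : (Fin p → ℝ) → ℝ≥0∞) (e : Fin n → ℝ) (t : ℝ) : EReal :=
  sSup {x : EReal | ∃ b : Fin p → ℝ, l2norm (X.mulVec (b - bs)) ≤ t ∧
      x = (dotp e (X.mulVec (b - bs)) : EReal) - (h b : EReal)} - ((t ^ 2 / 2 : ℝ) : EReal)

/-- `t_c = inf {‖X(β-β*)‖ : h(β) < ∞}`. -/
noncomputable def tcrit {n p : ℕ} (X : Matrix (Fin n) (Fin p) ℝ) (bs : Fin p → ℝ)
    (h : (Fin p → ℝ) → ℝ≥0∞) : ℝ :=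
  sInf {r : ℝ | ∃ b : Fin p → ℝ, h b ≠ ⊤ ∧ r = l2norm (X.mulVec (b - bs))}

/-- `f(t) = E[F(t)]`, with value `-∞` for `t < t_c`. -/
noncomputable def fInt {n p : ℕ} (X : Matrix (Fin n) (Fin p) ℝ) (bs : Fin p → ℝ)
    (h : (Fin p → ℝ) → ℝ≥0∞) {Ω : Type*} [MeasurableSpace Ω] (P : Measure Ω)
    (ε : Ω → Fin n → ℝ) (t : ℝ) : EReal :=
  if t < tcrit X bs h then ⊥
  else ((∫ ω, (Fval X bs h (ε ω) t).toReal ∂P : ℝ) : EReal)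

open Filter Topology

section L2norm

variable {k : ℕ}

lemma l2norm_eq_norm (v : Fin k → ℝ) : l2norm v = ‖WithLp.toLp 2 v‖ := by
  simp [l2norm, EuclideanSpace.norm_eq]

lemma l2norm_nonneg (v : Fin k → ℝ) : 0 ≤ l2norm v := Real.sqrt_nonneg _

lemma sq_l2norm (v : Fin k → ℝ) : l2norm v ^ 2 = ∑ i, v i ^ 2 :=
  Real.sq_sqrt (Finset.sum_nonneg fun _ _ => sq_nonneg _)

lemma l2norm_add_le (u v : Fin k → ℝ) : l2norm (u + v) ≤ l2norm u + l2norm v := by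
  simpa only [l2norm_eq_norm, WithLp.toLp_add] using norm_add_le _ _

lemma l2norm_smul (a : ℝ) (v : Fin k → ℝ) : l2norm (a • v) = |a| * l2norm v := by
  simp only [l2norm_eq_norm, WithLp.toLp_smul, norm_smul, Real.norm_eq_abs]

lemma abs_l2norm_sub_le (u v : Fin k → ℝ) : |l2norm u - l2norm v| ≤ l2norm (u - v) := by
  simpa only [l2norm_eq_norm, WithLp.toLp_sub] using abs_norm_sub_norm_le _ _

lemma dotp_le (u v : Fin k → ℝ) : dotp u v ≤ l2norm u * l2norm v :=
  Real.sum_mul_le_sqrt_mul_sqrt _ _ _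

lemma l2norm_le_sqrt_mul_norm (v : Fin k → ℝ) : l2norm v ≤ √k * ‖v‖ := by
  refine Real.sqrt_le_iff.2 ⟨by positivity, ?_⟩
  rw [mul_pow, Real.sq_sqrt (Nat.cast_nonneg _)]
  calc ∑ i, v i ^ 2 ≤ ∑ _i : Fin k, ‖v‖ ^ 2 := by
        refine Finset.sum_le_sum fun i _ => ?_
        rw [← sq_abs]
        gcongr
        exact norm_le_pi_norm v i
    _ = k * ‖v‖ ^ 2 := by simp

lemma lipschitzWith_of_abs_sub_le_l2norm {f : (Fin k → ℝ) → ℝ} {L : ℝ} (hL : 0 ≤ L)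
    (hf : ∀ x y, |f x - f y| ≤ L * l2norm (x - y)) :
    LipschitzWith (Real.toNNReal (L * √k)) f := by
  refine LipschitzWith.of_dist_le_mul fun x y => ?_
  rw [Real.coe_toNNReal _ (by positivity), Real.dist_eq, dist_eq_norm, mul_assoc]
  exact (hf x y).trans (by gcongr; exact l2norm_le_sqrt_mul_norm _)

end L2norm

section GaussianPoincare

/-- The law of a Gaussian vector on `ℝ^n` with i.i.d. `N(0, v)` coordinates. -/
noncomputable abbrev gaussianPi (n : ℕ) (v : ℝ≥0) : Measure (Fin n → ℝ) :=
  Measure.pi fun _ : Fin n => gaussianReal 0 v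

variable {n : ℕ} {v : ℝ≥0}

lemma MeasureTheory.Measure.AbsolutelyContinuous.pi_fin {n : ℕ} {α : Type*} [MeasurableSpace α]
    {μ ν : Measure α} [SigmaFinite μ] [SigmaFinite ν] (h : μ ≪ ν) :
    (Measure.pi fun _ : Fin n => μ) ≪ Measure.pi fun _ : Fin n => ν := by
  induction n with
  | zero => rw [Measure.pi_of_empty, Measure.pi_of_empty]
  | succ n ih =>
    rw [← (measurePreserving_piFinSuccAbove (fun _ : Fin (n + 1) => μ) 0).symm.map_eq,
      ← (measurePreserving_piFinSuccAbove (fun _ : Fin (n + 1) => ν) 0).symm.map_eq]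
    exact (h.prod ih).map (MeasurableEquiv.measurable _)

instance isGaussian_gaussianPi : IsGaussian (gaussianPi n v) := by
  have h : HasGaussianLaw (fun x : Fin n → ℝ => (x ·)) (gaussianPi n v) := by
    refine iIndepFun.hasGaussianLaw (X := fun i (x : Fin n → ℝ) => x i) (fun i => ⟨?_⟩) ?_
    · rw [(measurePreserving_eval (fun _ : Fin n => gaussianReal 0 v) i).map_eq]
      infer_instance
    · exact iIndepFun_pi (X := fun (_ : Fin n) (x : ℝ) => x) (fun i => by fun_prop)
  simpa using h.isGaussian_map

lemma memLp_eval_gaussianPi (i : Fin n) : MemLp (fun x : Fin n → ℝ => x i) 2 (gaussianPi n v) :=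
  (memLp_id_gaussianReal 2).comp_measurePreserving
    (measurePreserving_eval (fun _ : Fin n => gaussianReal 0 v) i)

lemma integral_dual_gaussianPi (l : StrongDual ℝ (Fin n → ℝ)) : (gaussianPi n v)[l] = 0 := by
  have h : ∀ x, l x = ∑ i, x i * l (Pi.single i 1) := fun x => by
    conv_lhs => rw [pi_eq_sum_univ' x, map_sum]
    simp only [map_smul, smul_eq_mul]
  obtain ⟨c, hc⟩ : ∃ c : Fin n → ℝ, ∀ i, l (Pi.single i 1) = c i := ⟨_, fun _ => rfl⟩
  simp only [hc] at h
  simp only [h]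
  rw [integral_finsetSum _ fun i _ =>
    ((memLp_eval_gaussianPi i).integrable (by norm_num)).mul_const _]
  refine Finset.sum_eq_zero fun i _ => ?_
  rw [integral_mul_const, integral_comp_eval (μ := fun _ : Fin n => gaussianReal 0 v)
    (f := fun x : ℝ => x) aestronglyMeasurable_id, integral_id_gaussianReal, zero_mul]

lemma integral_sq_dual_gaussianPi (l : StrongDual ℝ (Fin n → ℝ)) :
    ∫ x, l x ^ 2 ∂gaussianPi n v = v * ∑ i, l (Pi.single i 1) ^ 2 := by
  have h : ⇑l = ∑ i, fun x : Fin n → ℝ => l (Pi.single i 1) * x i := by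
    ext x
    conv_lhs => rw [pi_eq_sum_univ' x, map_sum]
    simp only [map_smul, smul_eq_mul, Finset.sum_apply, mul_comm]
  obtain ⟨c, hc⟩ : ∃ c : Fin n → ℝ, ∀ i, l (Pi.single i 1) = c i := ⟨_, fun _ => rfl⟩
  simp only [hc] at h ⊢
  rw [← variance_of_integral_eq_zero l.continuous.measurable.aemeasurable
    (integral_dual_gaussianPi l), h,
    variance_sum_pi (X := fun (i : Fin n) (x : ℝ) => c i * x)
      fun i => (memLp_id_gaussianReal 2).const_mul _, Finset.mul_sum]
  refine Finset.sum_congr rfl fun i _ => ?_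
  rw [variance_const_mul, variance_fun_id_gaussianReal]
  exact mul_comm _ _

lemma integral_sq_gaussianPi_prod_le {f : (Fin n → ℝ) → ℝ} {L : ℝ} (hL : 0 ≤ L)
    (hf : ∀ x y, |f x - f y| ≤ L * l2norm (x - y)) {x : Fin n → ℝ} (hx : DifferentiableAt ℝ f x) :
    ∫ y, (fderiv ℝ f x y) ^ 2 ∂gaussianPi n v ≤ v * L ^ 2 := by
  rw [integral_sq_dual_gaussianPi]
  gcongr
  set l := fderiv ℝ f x
  set c : Fin n → ℝ := fun i => l (Pi.single i 1)
  have hlc : l c = l2norm c ^ 2 := by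
    rw [sq_l2norm]
    conv_lhs => rw [pi_eq_sum_univ' c, map_sum]
    simp only [map_smul, smul_eq_mul, c, sq]
  have hle : l c ≤ L * l2norm c := by
    have hd : HasDerivAt (fun t : ℝ => f (x + t • c)) (l c) 0 := by
      have := hx.hasFDerivAt.hasLineDerivAt c
      exact this
    have ht := hd.tendsto_slope_zero_right
    refine le_of_tendsto ht ?_
    filter_upwards [self_mem_nhdsWithin] with t (ht : 0 < t)
    have := (le_abs_self _).trans (hf (x + t • c) x)
    rw [add_sub_cancel_left, l2norm_smul, abs_of_pos ht] at this
    simp only [zero_add, zero_smul, add_zero, smul_eq_mul]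
    rw [inv_mul_le_iff₀ ht]
    linarith
  have h0 := l2norm_nonneg c
  have : l2norm c ≤ L := by
    by_contra! hlt
    nlinarith
  calc ∑ i, c i ^ 2 = l2norm c ^ 2 := (sq_l2norm c).symm
    _ ≤ L ^ 2 := by gcongr

lemma memLp_eval_fst (i : Fin n) : MemLp (fun z : (Fin n → ℝ) × (Fin n → ℝ) => z.1 i) 2
    ((gaussianPi n v).prod (gaussianPi n v)) :=
  (memLp_eval_gaussianPi i).comp_measurePreserving measurePreserving_fst

lemma memLp_eval_snd (i : Fin n) : MemLp (fun z : (Fin n → ℝ) × (Fin n → ℝ) => z.2 i) 2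
    ((gaussianPi n v).prod (gaussianPi n v)) :=
  (memLp_eval_gaussianPi i).comp_measurePreserving measurePreserving_snd

lemma integrable_sum_sq_gaussianPi_prod :
    Integrable (fun z : (Fin n → ℝ) × (Fin n → ℝ) => ∑ i, (z.1 i ^ 2 + z.2 i ^ 2))
      ((gaussianPi n v).prod (gaussianPi n v)) :=
  integrable_finsetSum _ fun i _ =>
    (memLp_eval_fst i).integrable_sq.add (memLp_eval_snd i).integrable_sq

/-- The increment of `f` along the rotation of angle `θ` of the pair `z`. -/
noncomputable def rotIncrement (f : (Fin n → ℝ) → ℝ) (θ : ℝ) (z : (Fin n → ℝ) × (Fin n → ℝ)) : ℝ :=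
  f (Real.cos θ • z.1 + Real.sin θ • z.2) - f z.1

lemma map_rotation_gaussianPi (θ : ℝ) :
    ((gaussianPi n v).prod (gaussianPi n v)).map (ContinuousLinearMap.rotation θ) =
      (gaussianPi n v).prod (gaussianPi n v) :=
  IsGaussian.map_rotation_eq_self_of_forall_strongDual_eq_zero integral_dual_gaussianPi θ

lemma rotIncrement_sq_le {f : (Fin n → ℝ) → ℝ} {L : ℝ}
    (hf : ∀ x y, |f x - f y| ≤ L * l2norm (x - y)) (θ : ℝ) (z : (Fin n → ℝ) × (Fin n → ℝ)) :
    rotIncrement f θ z ^ 2 ≤ θ ^ 2 * (2 * L ^ 2 * ∑ i, (z.1 i ^ 2 + z.2 i ^ 2)) := by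
  have h1 : rotIncrement f θ z ^ 2 ≤
      (L * l2norm (Real.cos θ • z.1 + Real.sin θ • z.2 - z.1)) ^ 2 := by
    rw [← sq_abs]
    gcongr
    exact hf _ _
  refine h1.trans ?_
  rw [mul_pow, sq_l2norm, Finset.mul_sum, Finset.mul_sum, Finset.mul_sum]
  refine Finset.sum_le_sum fun i _ => ?_
  simp only [Pi.sub_apply, Pi.add_apply, Pi.smul_apply, smul_eq_mul]
  have hs : Real.sin θ ^ 2 ≤ θ ^ 2 := sq_le_sq.2 Real.abs_sin_le_abs
  have hc : (1 - Real.cos θ) ^ 2 ≤ θ ^ 2 := by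
    have := Real.one_sub_sq_div_two_le_cos (x := θ)
    have h2 := Real.cos_le_one θ
    have h3 := Real.neg_one_le_cos θ
    nlinarith
  have key : (Real.cos θ * z.1 i + Real.sin θ * z.2 i - z.1 i) ^ 2 ≤
      θ ^ 2 * (2 * (z.1 i ^ 2 + z.2 i ^ 2)) := by
    have e : (Real.cos θ * z.1 i + Real.sin θ * z.2 i - z.1 i) ^ 2 =
      2 * ((1 - Real.cos θ) ^ 2 * z.1 i ^ 2 + Real.sin θ ^ 2 * z.2 i ^ 2) -
        ((1 - Real.cos θ) * z.1 i + Real.sin θ * z.2 i) ^ 2 := by ring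
    have a1 := mul_le_mul_of_nonneg_right hc (sq_nonneg (z.1 i))
    have a2 := mul_le_mul_of_nonneg_right hs (sq_nonneg (z.2 i))
    have := sq_nonneg ((1 - Real.cos θ) * z.1 i + Real.sin θ * z.2 i)
    linarith
  calc _ ≤ L ^ 2 * (θ ^ 2 * (2 * (z.1 i ^ 2 + z.2 i ^ 2))) := by gcongr
    _ = _ := by ring

lemma continuous_rotIncrement {f : (Fin n → ℝ) → ℝ} (hf : Continuous f) (θ : ℝ) :
    Continuous (rotIncrement f θ) := by
  unfold rotIncrement
  fun_prop

lemma integrable_rotIncrement_sq {f : (Fin n → ℝ) → ℝ} {L : ℝ} (hL : 0 ≤ L)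
    (hf : ∀ x y, |f x - f y| ≤ L * l2norm (x - y)) (θ : ℝ) :
    Integrable (fun z => rotIncrement f θ z ^ 2) ((gaussianPi n v).prod (gaussianPi n v)) := by
  have hcont := (lipschitzWith_of_abs_sub_le_l2norm hL hf).continuous
  refine ((integrable_sum_sq_gaussianPi_prod.const_mul (2 * L ^ 2)).const_mul (θ ^ 2)).mono'
    ((continuous_rotIncrement hcont θ).pow 2).aestronglyMeasurable (ae_of_all _ fun z => ?_)
  rw [Real.norm_eq_abs, abs_of_nonneg (sq_nonneg _)]
  exact rotIncrement_sq_le hf θ z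

lemma rotIncrement_comp_rotation (f : (Fin n → ℝ) → ℝ) (a b : ℝ) (z : (Fin n → ℝ) × (Fin n → ℝ)) :
    rotIncrement f a (ContinuousLinearMap.rotation b z) =
      rotIncrement f (b + a) z - rotIncrement f b z := by
  simp only [rotIncrement, ContinuousLinearMap.rotation_apply, sub_sub_sub_cancel_right]
  congr 2
  ext i
  simp only [Pi.add_apply, Pi.smul_apply, smul_eq_mul, Real.cos_add, Real.sin_add]
  ring

lemma integral_rotIncrement_sq_le_nat_sq_mul {f : (Fin n → ℝ) → ℝ} {L : ℝ} (hL : 0 ≤ L)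
    (hf : ∀ x y, |f x - f y| ≤ L * l2norm (x - y)) (N : ℕ) (θ : ℝ) :
    ∫ z, rotIncrement f (N * θ) z ^ 2 ∂(gaussianPi n v).prod (gaussianPi n v) ≤
      N ^ 2 * ∫ z, rotIncrement f θ z ^ 2 ∂(gaussianPi n v).prod (gaussianPi n v) := by
  set μ := (gaussianPi n v).prod (gaussianPi n v)
  have hrot : ∀ b, MeasurePreserving (ContinuousLinearMap.rotation b) μ μ := fun b =>
    ⟨ContinuousLinearMap.measurable _, map_rotation_gaussianPi b⟩
  have hcont := (lipschitzWith_of_abs_sub_le_l2norm hL hf).continuous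
  have hint : ∀ b, Integrable
      (fun z => rotIncrement f θ (ContinuousLinearMap.rotation b z) ^ 2) μ := fun b =>
    (hrot b).integrable_comp_of_integrable (integrable_rotIncrement_sq hL hf θ)
  have hval : ∀ b, ∫ z, rotIncrement f θ (ContinuousLinearMap.rotation b z) ^ 2 ∂μ =
      ∫ z, rotIncrement f θ z ^ 2 ∂μ := fun b => by
    conv_rhs => rw [← (hrot b).map_eq]
    exact (integral_map (f := fun z => rotIncrement f θ z ^ 2)
      (ContinuousLinearMap.measurable _).aemeasurable
      ((continuous_rotIncrement hcont θ).pow 2).aestronglyMeasurable).symm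
  have htel : ∀ z, rotIncrement f (N * θ) z = ∑ k ∈ Finset.range N,
      rotIncrement f θ (ContinuousLinearMap.rotation (k * θ) z) := fun z => by
    simp_rw [rotIncrement_comp_rotation]
    have := Finset.sum_range_sub (fun k : ℕ => rotIncrement f (k * θ) z) N
    simp only [Nat.cast_add, Nat.cast_one, add_mul, one_mul, Nat.cast_zero, zero_mul] at this
    rw [this]
    simp [rotIncrement]
  calc ∫ z, rotIncrement f (N * θ) z ^ 2 ∂μ
      ≤ ∫ z, N * ∑ k ∈ Finset.range N,
        rotIncrement f θ (ContinuousLinearMap.rotation (k * θ) z) ^ 2 ∂μ := by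
        refine integral_mono (integrable_rotIncrement_sq hL hf _)
          ((integrable_finsetSum _ fun k _ => hint _).const_mul _) fun z => ?_
        simp only [htel]
        simpa using sq_sum_le_card_mul_sum_sq (s := Finset.range N)
          (f := fun k : ℕ => rotIncrement f θ (ContinuousLinearMap.rotation (k * θ) z))
    _ = N ^ 2 * ∫ z, rotIncrement f θ z ^ 2 ∂μ := by
        rw [integral_const_mul, integral_finsetSum _ fun k _ => hint _]
        simp only [hval, Finset.sum_const, Finset.card_range, nsmul_eq_mul]
        ring

lemma tendsto_rotIncrement_div {f : (Fin n → ℝ) → ℝ} {z : (Fin n → ℝ) × (Fin n → ℝ)}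
    (hz : DifferentiableAt ℝ f z.1) :
    Tendsto (fun θ => θ⁻¹ * rotIncrement f θ z) (𝓝[≠] 0) (𝓝 (fderiv ℝ f z.1 z.2)) := by
  have hg : HasDerivAt (fun θ : ℝ => Real.cos θ • z.1 + Real.sin θ • z.2) z.2 0 := by
    simpa using ((Real.hasDerivAt_cos 0).smul_const z.1).fun_add
      ((Real.hasDerivAt_sin 0).smul_const z.2)
  have hd : HasDerivAt (fun θ : ℝ => f (Real.cos θ • z.1 + Real.sin θ • z.2))
      (fderiv ℝ f z.1 z.2) 0 := by
    refine HasFDerivAt.comp_hasDerivAt (l := f)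
      (f := fun θ : ℝ => Real.cos θ • z.1 + Real.sin θ • z.2) 0 ?_ hg
    simpa using hz.hasFDerivAt
  simpa [rotIncrement] using hd.tendsto_slope_zero

/-- The **Gaussian Poincaré inequality** for Lipschitz functions, up to a constant, in terms of an
independent copy. -/
lemma integral_sub_sq_gaussianPi_prod_le (hv : v ≠ 0) {f : (Fin n → ℝ) → ℝ} {L : ℝ} (hL : 0 ≤ L)
    (hf : ∀ x y, |f x - f y| ≤ L * l2norm (x - y)) :
    ∫ z, (f z.2 - f z.1) ^ 2 ∂(gaussianPi n v).prod (gaussianPi n v) ≤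
      (Real.pi / 2) ^ 2 * (v * L ^ 2) := by
  set μ := (gaussianPi n v).prod (gaussianPi n v) with hμ
  have hlip := lipschitzWith_of_abs_sub_le_l2norm hL hf
  have hdiff : ∀ᵐ z ∂μ, DifferentiableAt ℝ f z.1 :=
    Measure.quasiMeasurePreserving_fst.ae
      ((Measure.AbsolutelyContinuous.pi_fin (gaussianReal_absolutelyContinuous 0 hv)).ae_le
        hlip.ae_differentiableAt)
  set θ : ℕ → ℝ := fun N => Real.pi / 2 / ((N + 1 : ℕ) : ℝ)
  have hθ0 : ∀ N, θ N ≠ 0 := fun N => by positivity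
  have hθ : Tendsto θ atTop (𝓝[≠] 0) := by
    refine tendsto_nhdsWithin_iff.2 ⟨?_, .of_forall hθ0⟩
    exact (tendsto_const_div_atTop_nhds_zero_nat _).comp (tendsto_add_atTop_nat 1)
  have hlim : ∀ᵐ z ∂μ, Tendsto (fun N => ((θ N)⁻¹ * rotIncrement f (θ N) z) ^ 2) atTop
      (𝓝 ((fderiv ℝ f z.1 z.2) ^ 2)) := by
    filter_upwards [hdiff] with z hz
    exact ((tendsto_rotIncrement_div hz).comp hθ).pow 2
  have hbound : ∀ N z, ((θ N)⁻¹ * rotIncrement f (θ N) z) ^ 2 ≤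
      2 * L ^ 2 * ∑ i, (z.1 i ^ 2 + z.2 i ^ 2) := fun N z => by
    have := rotIncrement_sq_le hf (θ N) z
    rw [mul_pow, inv_pow, inv_mul_le_iff₀ (by have := hθ0 N; positivity)]
    exact this
  have hmeas : ∀ N, AEStronglyMeasurable (fun z => ((θ N)⁻¹ * rotIncrement f (θ N) z) ^ 2) μ :=
    fun N => (((continuous_rotIncrement hlip.continuous _).const_mul _).pow 2).aestronglyMeasurable
  have hgint := (integrable_sum_sq_gaussianPi_prod (n := n) (v := v)).const_mul (2 * L ^ 2)
  have htend := tendsto_integral_of_dominated_convergence _ hmeas hgint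
    (fun N => ae_of_all _ fun z => by
      rw [Real.norm_eq_abs, abs_of_nonneg (sq_nonneg _)]
      exact hbound N z) hlim
  have hint : Integrable (fun z => (fderiv ℝ f z.1 z.2) ^ 2) μ := by
    refine hgint.mono' (aestronglyMeasurable_of_tendsto_ae atTop hmeas hlim) ?_
    filter_upwards [hlim] with z hz
    rw [Real.norm_eq_abs, abs_of_nonneg (sq_nonneg _)]
    exact le_of_tendsto hz (.of_forall fun N => hbound N z)
  have hfin : ∫ z, (fderiv ℝ f z.1 z.2) ^ 2 ∂μ ≤ v * L ^ 2 := by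
    rw [hμ, integral_prod _ hint]
    calc _ ≤ ∫ _, (v : ℝ) * L ^ 2 ∂gaussianPi n v := by
          refine integral_mono_ae hint.integral_prod_left (integrable_const _) ?_
          filter_upwards [(Measure.AbsolutelyContinuous.pi_fin
            (gaussianReal_absolutelyContinuous 0 hv)).ae_le hlip.ae_differentiableAt] with x hx
          exact integral_sq_gaussianPi_prod_le hL hf hx
      _ = _ := by simp
  have hN : ∀ N, ∫ z, (f z.2 - f z.1) ^ 2 ∂μ ≤
      (Real.pi / 2) ^ 2 * ∫ z, ((θ N)⁻¹ * rotIncrement f (θ N) z) ^ 2 ∂μ := fun N => by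
    have := integral_rotIncrement_sq_le_nat_sq_mul (v := v) hL hf (N + 1) (θ N)
    have e : ((N + 1 : ℕ) : ℝ) * θ N = Real.pi / 2 := by
      simp only [θ]
      field_simp
    rw [e] at this
    simp only [mul_pow]
    rw [integral_const_mul, ← mul_assoc, ← mul_pow]
    have e2 : Real.pi / 2 * (θ N)⁻¹ = ((N + 1 : ℕ) : ℝ) := by
      rw [← e, mul_inv_cancel_right₀ (hθ0 N)]
    rw [e2]
    simpa [rotIncrement] using this
  exact (ge_of_tendsto (htend.const_mul _) (.of_forall hN)).trans (by gcongr)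

end GaussianPoincare

section GaussianConcentration

variable {n : ℕ} {v : ℝ≥0} {f : (Fin n → ℝ) → ℝ} {L : ℝ}

lemma memLp_two_gaussianPi (hL : 0 ≤ L) (hf : ∀ x y, |f x - f y| ≤ L * l2norm (x - y)) :
    MemLp f 2 (gaussianPi n v) := by
  have hcont := (lipschitzWith_of_abs_sub_le_l2norm hL hf).continuous
  rw [memLp_two_iff_integrable_sq hcont.aestronglyMeasurable]
  have hdom : Integrable (fun x : Fin n → ℝ => 2 * f 0 ^ 2 + 2 * L ^ 2 * ∑ i, x i ^ 2)
      (gaussianPi n v) :=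
    (integrable_const _).add
      ((integrable_finsetSum _ fun i _ => (memLp_eval_gaussianPi i).integrable_sq).const_mul _)
  refine hdom.mono' (hcont.pow 2).aestronglyMeasurable (ae_of_all _ fun x => ?_)
  have h1 := hf x 0
  rw [sub_zero] at h1
  have h2 : (f x - f 0) ^ 2 ≤ (L * l2norm x) ^ 2 := by
    rw [← sq_abs]
    gcongr
  rw [mul_pow, sq_l2norm] at h2
  rw [Real.norm_eq_abs, abs_of_nonneg (sq_nonneg _)]
  nlinarith [sq_nonneg (f x - 2 * f 0)]

lemma integrable_gaussianPi (hL : 0 ≤ L) (hf : ∀ x y, |f x - f y| ≤ L * l2norm (x - y)) :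
    Integrable f (gaussianPi n v) :=
  (memLp_two_gaussianPi hL hf).integrable (by norm_num)

lemma variance_gaussianPi_le (hv : v ≠ 0) (hL : 0 ≤ L)
    (hf : ∀ x y, |f x - f y| ≤ L * l2norm (x - y)) :
    2 * Var[f; gaussianPi n v] ≤ (Real.pi / 2) ^ 2 * (v * L ^ 2) := by
  have hLp := memLp_two_gaussianPi (v := v) hL hf
  have h1 := hLp.integrable (by norm_num)
  have h2 := hLp.integrable_sq
  convert integral_sub_sq_gaussianPi_prod_le hv hL hf using 1
  have e : ∀ z : (Fin n → ℝ) × (Fin n → ℝ),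
      (f z.2 - f z.1) ^ 2 = f z.2 ^ 2 + f z.1 ^ 2 - 2 * (f z.1 * f z.2) := fun z => by ring
  simp only [e]
  rw [integral_sub (f := fun z : (Fin n → ℝ) × (Fin n → ℝ) => f z.2 ^ 2 + f z.1 ^ 2)
      ((h2.comp_snd _).add (h2.comp_fst _)) ((h1.mul_prod h1).const_mul 2),
    integral_add (h2.comp_snd _) (h2.comp_fst _), integral_const_mul,
    integral_prod_mul (μ := gaussianPi n v) (ν := gaussianPi n v) f f,
    integral_fun_fst (μ := gaussianPi n v) (ν := gaussianPi n v) fun x => f x ^ 2,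
    integral_fun_snd (μ := gaussianPi n v) (ν := gaussianPi n v) fun x => f x ^ 2,
    variance_eq_sub hLp]
  simp
  ring

/-- If a Lipschitz function of a Gaussian vector deviates from its mean by at least `a` with
probability at least one half, then `a` is at most twice the standard deviation of a coordinate
times the Lipschitz constant. -/
lemma le_two_mul_of_half_le_gaussianPi {σ : ℝ≥0} (hσ : 0 < σ) (hL : 0 ≤ L)
    (hf : ∀ x y, |f x - f y| ≤ L * l2norm (x - y)) {a : ℝ}
    (ha : ENNReal.ofReal 0.5 ≤
      gaussianPi n (σ ^ 2) {x | a ≤ |f x - ∫ y, f y ∂gaussianPi n (σ ^ 2)|}) :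
    a ≤ 2 * σ * L := by
  rcases le_or_gt a 0 with h0 | h0
  · exact h0.trans (by positivity)
  have hch := ha.trans (meas_ge_le_variance_div_sq (memLp_two_gaussianPi hL hf) h0)
  rw [ENNReal.ofReal_le_ofReal_iff
      (by have := variance_nonneg f (gaussianPi n (σ ^ 2)); positivity),
    le_div_iff₀ (by positivity)] at hch
  have hvar := variance_gaussianPi_le (n := n) (v := σ ^ 2) (by positivity) hL hf
  have hpi : (Real.pi / 2) ^ 2 ≤ 2 ^ 2 := by
    have := Real.pi_pos
    gcongr
    linarith [Real.pi_le_four]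
  push_cast at hvar
  refine le_of_sq_le_sq ?_ (by positivity)
  have := mul_le_mul_of_nonneg_right hpi (show 0 ≤ (σ : ℝ) ^ 2 * L ^ 2 by positivity)
  linarith

end GaussianConcentration

section StrongConcavity

lemma add_le_of_forall_add_one_sub_mul_le {x y z : ℝ}
    (h : ∀ a : ℝ, 0 < a → a < 1 → x + (1 - a) * y ≤ z) : x + y ≤ z := by
  have ht : Tendsto (fun a : ℝ => x + (1 - a) * y) (𝓝[>] 0) (𝓝 (x + (1 - 0) * y)) :=
    (Continuous.tendsto (by fun_prop) 0).mono_left nhdsWithin_le_nhds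
  rw [sub_zero, one_mul] at ht
  refine le_of_tendsto ht ?_
  filter_upwards [Ioo_mem_nhdsGT one_pos] with a ha using h a ha.1 ha.2

lemma StrongConcaveOn.add_sq_le_of_isMaxOn {s : Set ℝ} {g : ℝ → ℝ} (hg : StrongConcaveOn s 1 g)
    {x₀ x : ℝ} (hx₀ : x₀ ∈ s) (hmax : IsMaxOn g s x₀) (hx : x ∈ s) :
    g x + (x - x₀) ^ 2 / 2 ≤ g x₀ := by
  refine add_le_of_forall_add_one_sub_mul_le fun a ha ha1 => ?_
  have h := hg.2 hx hx₀ ha.le (sub_nonneg.2 ha1.le) (by ring)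
  have hle := hmax (hg.1 hx hx₀ ha.le (sub_nonneg.2 ha1.le) (by ring))
  simp only [smul_eq_mul, Set.mem_ofPred_eq, Real.norm_eq_abs, sq_abs] at h hle
  have := h.trans hle
  refine le_of_mul_le_mul_left ?_ ha
  linarith

lemma StrongConcaveOn.add_sq_le_of_mem_segment {s : Set ℝ} {g : ℝ → ℝ}
    (hg : StrongConcaveOn s 1 g) {x₀ x y : ℝ} (hx₀ : x₀ ∈ s) (hmax : IsMaxOn g s x₀) (hx : x ∈ s)
    (hy : y ∈ segment ℝ x x₀) : g x + (y - x) ^ 2 / 2 ≤ g y := by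
  obtain ⟨a, b, ha, hb, hab, rfl⟩ := hy
  have h := hg.2 hx hx₀ ha hb hab
  have h0 := hg.add_sq_le_of_isMaxOn hx₀ hmax hx
  simp only [smul_eq_mul, Real.norm_eq_abs, sq_abs] at h ⊢
  obtain rfl : a = 1 - b := by linarith
  have h1 := mul_le_mul_of_nonneg_left h0 hb
  have h2 : 0 ≤ (1 - b) * b * (x - x₀) ^ 2 := by positivity
  nlinarith

end StrongConcavity

section PenalizedLeastSquares

variable {n p : ℕ} (X : Matrix (Fin n) (Fin p) ℝ) (bs : Fin p → ℝ) (h : (Fin p → ℝ) → ℝ≥0∞)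

/-- The prediction `X(β - β*)` relative to the target. -/
noncomputable abbrev predDiff (b : Fin p → ℝ) : Fin n → ℝ := X.mulVec (b - bs)

/-- The real-valued objective `εᵀX(β - β*) - h(β)`. -/
noncomputable def linObjective (e : Fin n → ℝ) (b : Fin p → ℝ) : ℝ :=
  dotp e (predDiff X bs b) - (h b).toReal

/-- The values of the objective on the feasible set at radius `t`. -/
def feasibleValues (e : Fin n → ℝ) (t : ℝ) : Set ℝ :=
  linObjective X bs h e '' {b | h b ≠ ⊤ ∧ l2norm (predDiff X bs b) ≤ t}

/-- The real-valued version of `Fval`. -/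
noncomputable def realF (e : Fin n → ℝ) (t : ℝ) : ℝ :=
  sSup (feasibleValues X bs h e t) - t ^ 2 / 2

variable {X bs h}

lemma predDiff_combo (b₁ b₂ : Fin p → ℝ) (a : ℝ) :
    predDiff X bs (a • b₁ + (1 - a) • b₂) =
      a • predDiff X bs b₁ + (1 - a) • predDiff X bs b₂ := by
  simp only [predDiff, ← Matrix.mulVec_smul, ← Matrix.mulVec_add]
  congr 1
  module

lemma l2norm_combo_sq (u w : Fin n → ℝ) (a : ℝ) :
    l2norm (a • u + (1 - a) • w) ^ 2 =
      a * l2norm u ^ 2 + (1 - a) * l2norm w ^ 2 - a * (1 - a) * l2norm (u - w) ^ 2 := by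
  simp only [sq_l2norm, Finset.mul_sum, ← Finset.sum_add_distrib, ← Finset.sum_sub_distrib]
  refine Finset.sum_congr rfl fun i _ => ?_
  simp only [Pi.add_apply, Pi.smul_apply, Pi.sub_apply, smul_eq_mul]
  ring

lemma dotp_combo (e u w : Fin n → ℝ) (a : ℝ) :
    dotp e (a • u + (1 - a) • w) = a * dotp e u + (1 - a) * dotp e w := by
  simp only [dotp, Finset.mul_sum, ← Finset.sum_add_distrib]
  refine Finset.sum_congr rfl fun i _ => ?_
  simp only [Pi.add_apply, Pi.smul_apply, smul_eq_mul]
  ring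

lemma dotp_sub_left (e e' u : Fin n → ℝ) : dotp (e - e') u = dotp e u - dotp e' u := by
  simp only [dotp, ← Finset.sum_sub_distrib, Pi.sub_apply, sub_mul]

lemma dotp_sub_right (e u w : Fin n → ℝ) : dotp e (u - w) = dotp e u - dotp e w := by
  simp only [dotp, ← Finset.sum_sub_distrib, Pi.sub_apply, mul_sub]

lemma l2norm_sub_sq (u e : Fin n → ℝ) :
    l2norm (u - e) ^ 2 = l2norm u ^ 2 - 2 * dotp e u + l2norm e ^ 2 := by
  simp only [sq_l2norm, dotp, Finset.mul_sum, ← Finset.sum_add_distrib, ← Finset.sum_sub_distrib]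
  refine Finset.sum_congr rfl fun i _ => ?_
  simp only [Pi.sub_apply]
  ring

section Convex

variable (hconv : ∀ b₁ b₂ : Fin p → ℝ, ∀ a : ℝ, 0 ≤ a → a ≤ 1 →
  h (a • b₁ + (1 - a) • b₂) ≤ ENNReal.ofReal a * h b₁ + ENNReal.ofReal (1 - a) * h b₂)
include hconv

lemma penalty_combo_ne_top {b₁ b₂ : Fin p → ℝ} (h₁ : h b₁ ≠ ⊤) (h₂ : h b₂ ≠ ⊤) {a : ℝ}
    (ha : 0 ≤ a) (ha1 : a ≤ 1) : h (a • b₁ + (1 - a) • b₂) ≠ ⊤ :=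
  ((hconv b₁ b₂ a ha ha1).trans_lt (by finiteness)).ne

lemma linObjective_combo_ge (e : Fin n → ℝ) {b₁ b₂ : Fin p → ℝ} (h₁ : h b₁ ≠ ⊤) (h₂ : h b₂ ≠ ⊤)
    {a : ℝ} (ha : 0 ≤ a) (ha1 : a ≤ 1) :
    a * linObjective X bs h e b₁ + (1 - a) * linObjective X bs h e b₂ ≤
      linObjective X bs h e (a • b₁ + (1 - a) • b₂) := by
  have hr := ENNReal.toReal_mono (by finiteness) (hconv b₁ b₂ a ha ha1)
  rw [ENNReal.toReal_add (by finiteness) (by finiteness), ENNReal.toReal_mul, ENNReal.toReal_mul,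
    ENNReal.toReal_ofReal ha, ENNReal.toReal_ofReal (sub_nonneg.2 ha1)] at hr
  simp only [linObjective, predDiff_combo, dotp_combo]
  linarith

end Convex

lemma linObjective_le (e : Fin n → ℝ) (b : Fin p → ℝ) {t : ℝ}
    (hb : l2norm (predDiff X bs b) ≤ t) : linObjective X bs h e b ≤ l2norm e * t := by
  have h1 := dotp_le e (predDiff X bs b)
  have h2 := mul_le_mul_of_nonneg_left hb (l2norm_nonneg e)
  have h3 : 0 ≤ (h b).toReal := ENNReal.toReal_nonneg
  unfold linObjective
  linarith

lemma bddAbove_feasibleValues (e : Fin n → ℝ) (t : ℝ) :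
    BddAbove (feasibleValues X bs h e t) := by
  refine ⟨l2norm e * t, ?_⟩
  rintro _ ⟨b, hb, rfl⟩
  exact linObjective_le e b hb.2

lemma linObjective_le_sSup (e : Fin n → ℝ) {b : Fin p → ℝ} (hb : h b ≠ ⊤) {t : ℝ}
    (ht : l2norm (predDiff X bs b) ≤ t) :
    linObjective X bs h e b ≤ sSup (feasibleValues X bs h e t) :=
  le_csSup (bddAbove_feasibleValues e t) ⟨b, ⟨hb, ht⟩, rfl⟩

section Attained

variable (hattained : ∃ b₀ : Fin p → ℝ, h b₀ ≠ ⊤ ∧ l2norm (X.mulVec (b₀ - bs)) = tcrit X bs h)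
include hattained

lemma feasibleValues_nonempty (e : Fin n → ℝ) {t : ℝ} (ht : tcrit X bs h ≤ t) :
    (feasibleValues X bs h e t).Nonempty := by
  obtain ⟨b₀, h₀, hb₀⟩ := hattained
  exact ⟨_, b₀, ⟨h₀, hb₀.trans_le ht⟩, rfl⟩

lemma tcrit_nonneg : 0 ≤ tcrit X bs h := by
  obtain ⟨b₀, -, hb₀⟩ := hattained
  exact hb₀ ▸ l2norm_nonneg _

lemma toReal_Fval (e : Fin n → ℝ) {t : ℝ} (ht : tcrit X bs h ≤ t) :
    (Fval X bs h e t).toReal = realF X bs h e t := by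
  have key : sSup {x : EReal | ∃ b : Fin p → ℝ, l2norm (X.mulVec (b - bs)) ≤ t ∧
      x = (dotp e (X.mulVec (b - bs)) : EReal) - (h b : EReal)} =
      ((sSup (feasibleValues X bs h e t) : ℝ) : EReal) := by
    have hcoe : ∀ b, h b ≠ ⊤ → (dotp e (X.mulVec (b - bs)) : EReal) - (h b : EReal) =
        (linObjective X bs h e b : EReal) := fun b hb => by
      rw [linObjective, EReal.coe_sub, ← EReal.coe_ennreal_toReal hb]
    apply le_antisymm
    · refine sSup_le ?_
      rintro _ ⟨b, hb, rfl⟩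
      by_cases hbt : h b = ⊤
      · simp [hbt]
      · rw [hcoe b hbt]
        exact_mod_cast linObjective_le_sSup e hbt hb
    · by_contra! hlt
      obtain ⟨c, hc, hc'⟩ := EReal.lt_iff_exists_real_btwn.1 hlt
      obtain ⟨_, ⟨b, hb, rfl⟩, hlt'⟩ := exists_lt_of_lt_csSup
        (feasibleValues_nonempty hattained e ht) (EReal.coe_lt_coe_iff.1 hc')
      refine (hc.trans (EReal.coe_lt_coe_iff.2 hlt')).not_ge (le_sSup ⟨b, hb.2, ?_⟩)
      rw [hcoe b hb.1]
  rw [Fval, key, ← EReal.coe_sub, EReal.toReal_coe, realF]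

lemma abs_realF_sub_le {t : ℝ} (ht : tcrit X bs h ≤ t) (e e' : Fin n → ℝ) :
    |realF X bs h e t - realF X bs h e' t| ≤ t * l2norm (e - e') := by
  have aux : ∀ e e' : Fin n → ℝ,
      realF X bs h e t - realF X bs h e' t ≤ t * l2norm (e - e') := fun e e' => by
    rw [realF, realF, sub_sub_sub_cancel_right, sub_le_iff_le_add]
    refine csSup_le (feasibleValues_nonempty hattained e ht) ?_
    rintro _ ⟨b, hb, rfl⟩
    have h1 := linObjective_le_sSup e' hb.1 hb.2
    have h2 := dotp_le (e - e') (predDiff X bs b)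
    have h3 := mul_le_mul_of_nonneg_left hb.2 (l2norm_nonneg (e - e'))
    rw [dotp_sub_left] at h2
    unfold linObjective at h1 ⊢
    linarith
  refine abs_sub_le_iff.2 ⟨aux e e', ?_⟩
  have hsymm : l2norm (e - e') = l2norm (e' - e) := by
    simp only [l2norm_eq_norm, WithLp.toLp_sub, norm_sub_rev]
  exact hsymm ▸ aux e' e

lemma strongConcaveOn_realF
    (hconv : ∀ b₁ b₂ : Fin p → ℝ, ∀ a : ℝ, 0 ≤ a → a ≤ 1 →
      h (a • b₁ + (1 - a) • b₂) ≤ ENNReal.ofReal a * h b₁ + ENNReal.ofReal (1 - a) * h b₂)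
    (e : Fin n → ℝ) : StrongConcaveOn (Set.Ici (tcrit X bs h)) 1 (realF X bs h e) := by
  refine ⟨convex_Ici _, fun s hs t ht a b ha hb hab => ?_⟩
  obtain rfl : b = 1 - a := by linarith
  simp only [smul_eq_mul, Real.norm_eq_abs, sq_abs, realF]
  suffices H : a * sSup (feasibleValues X bs h e s) + (1 - a) * sSup (feasibleValues X bs h e t) ≤
      sSup (feasibleValues X bs h e (a * s + (1 - a) * t)) by nlinarith
  refine le_of_forall_pos_le_add fun δ hδ => ?_
  obtain ⟨_, ⟨b₁, ⟨h₁, hs₁⟩, rfl⟩, hlt₁⟩ := exists_lt_of_lt_csSup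
    (feasibleValues_nonempty hattained e hs) (sub_lt_self _ hδ)
  obtain ⟨_, ⟨b₂, ⟨h₂, hs₂⟩, rfl⟩, hlt₂⟩ := exists_lt_of_lt_csSup
    (feasibleValues_nonempty hattained e ht) (sub_lt_self _ hδ)
  have hc := linObjective_combo_ge (X := X) (bs := bs) hconv e h₁ h₂ ha (by linarith : a ≤ 1)
  have hnorm : l2norm (predDiff X bs (a • b₁ + (1 - a) • b₂)) ≤ a * s + (1 - a) * t := by
    rw [predDiff_combo]
    refine (l2norm_add_le _ _).trans ?_
    rw [l2norm_smul, l2norm_smul, abs_of_nonneg ha, abs_of_nonneg hb]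
    gcongr
  have hle := linObjective_le_sSup e (penalty_combo_ne_top hconv h₁ h₂ ha (by linarith)) hnorm
  have m₁ := mul_le_mul_of_nonneg_left hlt₁.le ha
  have m₂ := mul_le_mul_of_nonneg_left hlt₂.le hb
  linarith

end Attained

section Estimator

variable {B : (Fin n → ℝ) → Fin p → ℝ}
  (hB : ∀ e : Fin n → ℝ, ∀ b : Fin p → ℝ,
    ENNReal.ofReal (l2norm (X.mulVec (B e) - (X.mulVec bs + e)) ^ 2) + 2 * h (B e) ≤
      ENNReal.ofReal (l2norm (X.mulVec b - (X.mulVec bs + e)) ^ 2) + 2 * h b)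
include hB

lemma penalty_estimator_ne_top (hproper : ∃ b, h b ≠ ⊤) (e : Fin n → ℝ) : h (B e) ≠ ⊤ := by
  obtain ⟨b, hb⟩ := hproper
  intro htop
  have := (hB e b).trans_lt (by finiteness)
  simp [htop] at this

lemma estimator_maximizes (e : Fin n → ℝ) {b : Fin p → ℝ} (hb : h b ≠ ⊤) :
    linObjective X bs h e b - l2norm (predDiff X bs b) ^ 2 / 2 ≤
      linObjective X bs h e (B e) - l2norm (predDiff X bs (B e)) ^ 2 / 2 := by
  have hBe := penalty_estimator_ne_top hB ⟨b, hb⟩ e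
  have hr := ENNReal.toReal_mono (by finiteness) (hB e b)
  rw [ENNReal.toReal_add (by finiteness) (by finiteness),
    ENNReal.toReal_add (by finiteness) (by finiteness),
    ENNReal.toReal_ofReal (sq_nonneg _), ENNReal.toReal_ofReal (sq_nonneg _),
    ENNReal.toReal_mul, ENNReal.toReal_mul, ENNReal.toReal_ofNat, ← sub_sub, ← sub_sub,
    ← Matrix.mulVec_sub, ← Matrix.mulVec_sub, l2norm_sub_sq, l2norm_sub_sq] at hr
  simp only [linObjective, predDiff]
  linarith

lemma estimator_maximizes_strongly
    (hconv : ∀ b₁ b₂ : Fin p → ℝ, ∀ a : ℝ, 0 ≤ a → a ≤ 1 →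
      h (a • b₁ + (1 - a) • b₂) ≤ ENNReal.ofReal a * h b₁ + ENNReal.ofReal (1 - a) * h b₂)
    (e : Fin n → ℝ) {b : Fin p → ℝ} (hb : h b ≠ ⊤) :
    linObjective X bs h e b - l2norm (predDiff X bs b) ^ 2 / 2 +
        l2norm (predDiff X bs b - predDiff X bs (B e)) ^ 2 / 2 ≤
      linObjective X bs h e (B e) - l2norm (predDiff X bs (B e)) ^ 2 / 2 := by
  have hBe := penalty_estimator_ne_top hB ⟨b, hb⟩ e
  refine add_le_of_forall_add_one_sub_mul_le fun a ha ha1 => ?_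
  have h1 := linObjective_combo_ge (X := X) (bs := bs) hconv e hb hBe ha.le ha1.le
  have h2 := estimator_maximizes hB e (penalty_combo_ne_top hconv hb hBe ha.le ha1.le)
  rw [predDiff_combo, l2norm_combo_sq] at h2
  refine le_of_mul_le_mul_left ?_ ha
  linarith

/-- The fitted values are a nonexpansive function of the noise, hence so is the prediction error. -/
lemma abs_predError_sub_le
    (hconv : ∀ b₁ b₂ : Fin p → ℝ, ∀ a : ℝ, 0 ≤ a → a ≤ 1 →
      h (a • b₁ + (1 - a) • b₂) ≤ ENNReal.ofReal a * h b₁ + ENNReal.ofReal (1 - a) * h b₂)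
    (hproper : ∃ b, h b ≠ ⊤) (e e' : Fin n → ℝ) :
    |l2norm (predDiff X bs (B e)) - l2norm (predDiff X bs (B e'))| ≤ 1 * l2norm (e - e') := by
  have h1 := estimator_maximizes_strongly hB hconv e (penalty_estimator_ne_top hB hproper e')
  have h2 := estimator_maximizes_strongly hB hconv e' (penalty_estimator_ne_top hB hproper e)
  have hsymm : l2norm (predDiff X bs (B e') - predDiff X bs (B e)) =
      l2norm (predDiff X bs (B e) - predDiff X bs (B e')) := by
    simp only [l2norm_eq_norm, WithLp.toLp_sub, norm_sub_rev]
  have hcs := dotp_le (e - e') (predDiff X bs (B e) - predDiff X bs (B e'))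
  rw [dotp_sub_left, dotp_sub_right, dotp_sub_right] at hcs
  rw [hsymm] at h1
  refine (abs_l2norm_sub_le _ _).trans ?_
  unfold linObjective at h1 h2
  set d := l2norm (predDiff X bs (B e) - predDiff X bs (B e'))
  have hd : 0 ≤ d := l2norm_nonneg _
  have he := l2norm_nonneg (e - e')
  by_contra! hlt
  nlinarith

lemma tcrit_le_predError (hproper : ∃ b, h b ≠ ⊤) (e : Fin n → ℝ) :
    tcrit X bs h ≤ l2norm (predDiff X bs (B e)) := by
  refine csInf_le ⟨0, ?_⟩ ⟨B e, penalty_estimator_ne_top hB hproper e, rfl⟩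
  rintro _ ⟨b, -, rfl⟩
  exact l2norm_nonneg _

/-- The prediction error maximizes `F`. -/
lemma isMaxOn_realF_predError
    (hattained : ∃ b₀ : Fin p → ℝ, h b₀ ≠ ⊤ ∧ l2norm (X.mulVec (b₀ - bs)) = tcrit X bs h)
    (e : Fin n → ℝ) :
    IsMaxOn (realF X bs h e) (Set.Ici (tcrit X bs h)) (l2norm (predDiff X bs (B e))) := by
  intro t ht
  have hproper : ∃ b, h b ≠ ⊤ := hattained.imp fun _ hb => hb.1
  simp only [Set.mem_ofPred_eq, realF]
  rw [sub_le_iff_le_add]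
  refine csSup_le (feasibleValues_nonempty hattained e ht) ?_
  rintro _ ⟨b, ⟨hb, hbt⟩, rfl⟩
  have h1 := estimator_maximizes hB e hb
  have h2 := linObjective_le_sSup (X := X) (bs := bs) e
    (penalty_estimator_ne_top hB hproper e) le_rfl
  have h3 : l2norm (predDiff X bs b) ^ 2 ≤ t ^ 2 := by
    have := l2norm_nonneg (predDiff X bs b)
    gcongr
  linarith

end Estimator

end PenalizedLeastSquares

section SqrtBounds

lemma abs_sqrt_sub_sqrt_le {a b c : ℝ} (ha : 0 ≤ a) (hb : 0 ≤ b)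
    (hab : (a - b) ^ 2 ≤ c * (a + b)) : |√a - √b| ≤ √c := by
  rcases (add_nonneg ha hb).eq_or_lt with h0 | h0
  · obtain rfl : a = 0 := by linarith
    obtain rfl : b = 0 := by linarith
    simp
  refine Real.abs_le_sqrt (le_of_mul_le_mul_right (hab.trans' ?_) h0)
  have hsa := Real.sq_sqrt ha
  have hsb := Real.sq_sqrt hb
  have hfac : (a - b) ^ 2 = (√a - √b) ^ 2 * (√a + √b) ^ 2 := by
    rw [← mul_pow]
    congr 1
    linear_combination hsb - hsa
  rw [hfac]
  gcongr
  nlinarith [Real.sqrt_nonneg a, Real.sqrt_nonneg b,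
    mul_nonneg (Real.sqrt_nonneg a) (Real.sqrt_nonneg b)]

lemma abs_sqrt_sub_sqrt_le_sqrt_abs_sub {a b : ℝ} (ha : 0 ≤ a) (hb : 0 ≤ b) :
    |√a - √b| ≤ √|a - b| := by
  refine abs_sqrt_sub_sqrt_le ha hb ?_
  rw [← sq_abs, sq]
  gcongr
  exact (abs_sub _ _).trans_eq (by rw [abs_of_nonneg ha, abs_of_nonneg hb])

end SqrtBounds

section Deviation

variable {n p : ℕ} {X : Matrix (Fin n) (Fin p) ℝ} {bs : Fin p → ℝ} {h : (Fin p → ℝ) → ℝ≥0∞}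

lemma continuous_realF
    (hattained : ∃ b₀ : Fin p → ℝ, h b₀ ≠ ⊤ ∧ l2norm (X.mulVec (b₀ - bs)) = tcrit X bs h)
    {t : ℝ} (ht : tcrit X bs h ≤ t) : Continuous fun e => realF X bs h e t :=
  (lipschitzWith_of_abs_sub_le_l2norm ((tcrit_nonneg hattained).trans ht)
    (abs_realF_sub_le hattained ht)).continuous

lemma integrable_realF
    (hattained : ∃ b₀ : Fin p → ℝ, h b₀ ≠ ⊤ ∧ l2norm (X.mulVec (b₀ - bs)) = tcrit X bs h)
    {t : ℝ} (ht : tcrit X bs h ≤ t) {v : ℝ≥0} :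
    Integrable (fun e => realF X bs h e t) (gaussianPi n v) :=
  integrable_gaussianPi ((tcrit_nonneg hattained).trans ht) (abs_realF_sub_le hattained ht)

lemma strongConcaveOn_integral_realF
    (hconv : ∀ b₁ b₂ : Fin p → ℝ, ∀ a : ℝ, 0 ≤ a → a ≤ 1 →
      h (a • b₁ + (1 - a) • b₂) ≤ ENNReal.ofReal a * h b₁ + ENNReal.ofReal (1 - a) * h b₂)
    (hattained : ∃ b₀ : Fin p → ℝ, h b₀ ≠ ⊤ ∧ l2norm (X.mulVec (b₀ - bs)) = tcrit X bs h)
    (v : ℝ≥0) :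
    StrongConcaveOn (Set.Ici (tcrit X bs h)) 1 fun t => ∫ e, realF X bs h e t ∂gaussianPi n v := by
  refine ⟨convex_Ici _, fun s hs t ht a b ha hb hab => ?_⟩
  have hs' := (integrable_realF hattained hs (v := v)).const_mul a
  have ht' := (integrable_realF hattained ht (v := v)).const_mul b
  have hst := integrable_realF hattained (convex_Ici _ hs ht ha hb hab) (v := v)
  calc _ = ∫ e, (a * realF X bs h e s + b * realF X bs h e t +
        a * b * (1 / (2 : ℝ) * ‖s - t‖ ^ 2)) ∂gaussianPi n v := by
        rw [integral_add (f := fun e => a * realF X bs h e s + b * realF X bs h e t)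
          (hs'.add ht') (integrable_const _), integral_add hs' ht', integral_const_mul,
          integral_const_mul]
        simp
    _ ≤ _ := integral_mono ((hs'.add ht').add (integrable_const _)) hst fun e =>
        (strongConcaveOn_realF hattained hconv e).2 hs ht ha hb hab

/-- If `F(m)` exceeds `F(t_f)` by `(m - t_f)² / 2` with probability at least one half, then `m` is
close to `t_f`. -/
lemma sq_sub_le_of_half_le
    (hconv : ∀ b₁ b₂ : Fin p → ℝ, ∀ a : ℝ, 0 ≤ a → a ≤ 1 →
      h (a • b₁ + (1 - a) • b₂) ≤ ENNReal.ofReal a * h b₁ + ENNReal.ofReal (1 - a) * h b₂)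
    (hattained : ∃ b₀ : Fin p → ℝ, h b₀ ≠ ⊤ ∧ l2norm (X.mulVec (b₀ - bs)) = tcrit X bs h)
    {σ : ℝ≥0} (hσ : 0 < σ) {tf m : ℝ} (htf : tcrit X bs h ≤ tf) (hm : tcrit X bs h ≤ m)
    (hmax : IsMaxOn (fun t => ∫ e, realF X bs h e t ∂gaussianPi n (σ ^ 2))
      (Set.Ici (tcrit X bs h)) tf)
    {s : Set (Fin n → ℝ)} (hs : ENNReal.ofReal 0.5 ≤ gaussianPi n (σ ^ 2) s)
    (hsm : ∀ e ∈ s, realF X bs h e tf + (m - tf) ^ 2 / 2 ≤ realF X bs h e m) :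
    (m - tf) ^ 2 ≤ 2 * σ * (m + tf) := by
  have h0 := tcrit_nonneg hattained
  have hlip : ∀ e e' : Fin n → ℝ, |(realF X bs h e m - realF X bs h e tf) -
      (realF X bs h e' m - realF X bs h e' tf)| ≤ (m + tf) * l2norm (e - e') := fun e e' => by
    rw [sub_sub_sub_comm, add_mul]
    exact (abs_sub _ _).trans (add_le_add (abs_realF_sub_le hattained hm e e')
      (abs_realF_sub_le hattained htf e e'))
  refine le_two_mul_of_half_le_gaussianPi hσ (by linarith) hlip (hs.trans (measure_mono ?_))
  intro e he
  have h1 := hsm e he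
  have h2 := (strongConcaveOn_integral_realF hconv hattained (σ ^ 2)).add_sq_le_of_isMaxOn
    htf hmax hm
  rw [Set.mem_ofPred_eq,
    integral_sub (integrable_realF hattained hm) (integrable_realF hattained htf)]
  refine le_trans ?_ (le_abs_self _)
  linarith

end Deviation

/-- the unique maximizer `t_f` of `f = E[F(·)]` satisfies
`|√t_f - √m| ≤ √(21σ/2) ≤ 3.25√σ` and
`|√t_f - √(E‖X(β̂-β*)‖)| ≤ √σ(√(21/2) + (π/2)^{1/4}) ≤ 4.40√σ`, where `m` is the median
of the prediction error. -/
theorem sqrt_tf_close_to_sqrt_median_and_mean {n p : ℕ}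
    (X : Matrix (Fin n) (Fin p) ℝ) (bs : Fin p → ℝ)
    (h : (Fin p → ℝ) → ℝ≥0∞)
    (hconv : ∀ b₁ b₂ : Fin p → ℝ, ∀ a : ℝ, 0 ≤ a → a ≤ 1 →
      h (a • b₁ + (1 - a) • b₂) ≤ ENNReal.ofReal a * h b₁ + ENNReal.ofReal (1 - a) * h b₂)
    (hproper : ∃ b : Fin p → ℝ, h b ≠ ⊤)
    (hattained : ∃ b₀ : Fin p → ℝ, h b₀ ≠ ⊤ ∧
      l2norm (X.mulVec (b₀ - bs)) = tcrit X bs h)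
    (B : (Fin n → ℝ) → Fin p → ℝ)
    (hB : ∀ e : Fin n → ℝ, ∀ b : Fin p → ℝ,
      ENNReal.ofReal (l2norm (X.mulVec (B e) - (X.mulVec bs + e)) ^ 2) + 2 * h (B e) ≤
        ENNReal.ofReal (l2norm (X.mulVec b - (X.mulVec bs + e)) ^ 2) + 2 * h b)
    {Ω : Type*} [MeasurableSpace Ω] (P : Measure Ω) [IsProbabilityMeasure P]
    (σ : ℝ≥0) (hσ : 0 < σ) (ε : Ω → Fin n → ℝ) (hmeas : Measurable ε)
    (hgauss : Measure.map ε P = Measure.pi fun _ : Fin n => gaussianReal 0 (σ ^ 2))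
    (tf : ℝ) (htf : ∀ t : ℝ, fInt X bs h P ε t ≤ fInt X bs h P ε tf)
    (m : ℝ)
    (hm₁ : ENNReal.ofReal 0.5 ≤ P {ω : Ω | l2norm (X.mulVec (B (ε ω) - bs)) ≤ m})
    (hm₂ : ENNReal.ofReal 0.5 ≤ P {ω : Ω | m ≤ l2norm (X.mulVec (B (ε ω) - bs))}) :
    |Real.sqrt tf - Real.sqrt m| ≤ Real.sqrt (21 * σ / 2) ∧
    Real.sqrt (21 * (σ : ℝ) / 2) ≤ 3.25 * Real.sqrt σ ∧
    |Real.sqrt tf - Real.sqrt (∫ ω, l2norm (X.mulVec (B (ε ω) - bs)) ∂P)| ≤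
      Real.sqrt σ * (Real.sqrt (21 / 2) + (Real.pi / 2) ^ ((1 : ℝ) / 4)) ∧
    Real.sqrt (σ : ℝ) * (Real.sqrt (21 / 2) + (Real.pi / 2) ^ ((1 : ℝ) / 4)) ≤
      4.40 * Real.sqrt σ := by
  set γ := gaussianPi n (σ ^ 2)
  have hmap : Measure.map ε P = γ := hgauss
  set R : (Fin n → ℝ) → ℝ := fun e => l2norm (predDiff X bs (B e))
  have hRlip : ∀ e e', |R e - R e'| ≤ 1 * l2norm (e - e') := abs_predError_sub_le hB hconv hproper
  have hRcont : Continuous R := (lipschitzWith_of_abs_sub_le_l2norm zero_le_one hRlip).continuous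
  have hRtc : ∀ e, tcrit X bs h ≤ R e := tcrit_le_predError hB hproper
  have hRmax : ∀ e, IsMaxOn (realF X bs h e) (Set.Ici (tcrit X bs h)) (R e) :=
    isMaxOn_realF_predError hB hattained
  have htc0 := tcrit_nonneg hattained
  have hγ₁ : ENNReal.ofReal 0.5 ≤ γ {e | R e ≤ m} := by
    rw [← hmap, Measure.map_apply hmeas (isClosed_le hRcont continuous_const).measurableSet]
    exact hm₁
  have hγ₂ : ENNReal.ofReal 0.5 ≤ γ {e | m ≤ R e} := by
    rw [← hmap, Measure.map_apply hmeas (isClosed_le continuous_const hRcont).measurableSet]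
    exact hm₂
  have hmean : ∫ ω, l2norm (X.mulVec (B (ε ω) - bs)) ∂P = ∫ e, R e ∂γ := by
    rw [← hmap, integral_map hmeas.aemeasurable hRcont.aestronglyMeasurable]
  have hfInt : ∀ t, tcrit X bs h ≤ t →
      fInt X bs h P ε t = ((∫ e, realF X bs h e t ∂γ : ℝ) : EReal) := fun t ht => by
    rw [fInt, if_neg ht.not_gt, ← hmap,
      integral_map hmeas.aemeasurable (continuous_realF hattained ht).aestronglyMeasurable]
    simp_rw [toReal_Fval hattained _ ht]
  have htftc : tcrit X bs h ≤ tf := by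
    by_contra! hlt
    have := htf (tcrit X bs h)
    rw [hfInt _ le_rfl, fInt, if_pos hlt, le_bot_iff] at this
    exact EReal.coe_ne_bot _ this
  have hmax : IsMaxOn (fun t => ∫ e, realF X bs h e t ∂γ) (Set.Ici (tcrit X bs h)) tf :=
    fun t ht => by
      have := htf t
      rw [hfInt t ht, hfInt tf htftc] at this
      exact_mod_cast this
  have hmtc : tcrit X bs h ≤ m := by
    obtain ⟨e, he⟩ : {e | R e ≤ m}.Nonempty := nonempty_of_measure_ne_zero fun h0 => by
      rw [h0] at hγ₁
      norm_num at hγ₁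
    exact (hRtc e).trans he
  have hmedian : (m - tf) ^ 2 ≤ 2 * σ * (m + tf) := by
    have hseg : ∀ e, m ∈ segment ℝ tf (R e) →
        realF X bs h e tf + (m - tf) ^ 2 / 2 ≤ realF X bs h e m := fun e he =>
      (strongConcaveOn_realF hattained hconv e).add_sq_le_of_mem_segment (hRtc e) (hRmax e) htftc he
    rcases le_total tf m with hle | hle
    · refine sq_sub_le_of_half_le hconv hattained hσ htftc hmtc hmax hγ₂ fun e he => hseg e ?_
      rw [segment_eq_Icc (hle.trans he)]
      exact ⟨hle, he⟩
    · refine sq_sub_le_of_half_le hconv hattained hσ htftc hmtc hmax hγ₁ fun e he => hseg e ?_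
      rw [segment_symm, segment_eq_Icc (le_trans he hle)]
      exact ⟨he, hle⟩
  have hmeanMedian : |m - ∫ e, R e ∂γ| ≤ 2 * σ := by
    rw [← mul_one (2 * (σ : ℝ))]
    rcases le_total (∫ e, R e ∂γ) m with hle | hle
    · refine le_two_mul_of_half_le_gaussianPi hσ zero_le_one hRlip (hγ₂.trans (measure_mono ?_))
      intro e (he : m ≤ R e)
      exact abs_le_abs_of_nonneg (sub_nonneg.2 hle) (by linarith)
    · refine le_two_mul_of_half_le_gaussianPi hσ zero_le_one hRlip (hγ₁.trans (measure_mono ?_))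
      intro e (he : R e ≤ m)
      exact abs_le_abs_of_nonpos (sub_nonpos.2 hle) (by linarith)
  have hsqrt : |√tf - √m| ≤ √(2 * σ) :=
    abs_sqrt_sub_sqrt_le (htc0.trans htftc) (htc0.trans hmtc) (by linarith)
  have hsplit : √(21 * (σ : ℝ) / 2) = √(21 / 2) * √σ := by
    rw [← Real.sqrt_mul (by norm_num)]
    ring_nf
  have h2σ : √(2 * (σ : ℝ)) ≤ 1.5 * √σ := by
    rw [Real.sqrt_mul (by norm_num)]
    gcongr
    rw [Real.sqrt_le_left (by norm_num)]
    norm_num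
  have hlow : (3 : ℝ) ≤ √(21 / 2) := Real.le_sqrt_of_sq_le (by norm_num)
  have hup : √(21 / 2 : ℝ) ≤ 3.25 := by
    rw [Real.sqrt_le_left (by norm_num)]
    norm_num
  have hpi0 : 0 ≤ (Real.pi / 2) ^ ((1 : ℝ) / 4) := by positivity
  have hsσ := Real.sqrt_nonneg (σ : ℝ)
  refine ⟨hsqrt.trans ?_, ?_, ?_, ?_⟩
  · gcongr
    linarith
  · rw [hsplit]
    gcongr
  · rw [hmean]
    have hR0 : 0 ≤ ∫ e, R e ∂γ := integral_nonneg fun e => l2norm_nonneg _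
    calc |√tf - √(∫ e, R e ∂γ)| ≤ |√tf - √m| + |√m - √(∫ e, R e ∂γ)| := abs_sub_le _ _ _
      _ ≤ √(2 * σ) + √(2 * σ) := by
          gcongr
          exact (abs_sqrt_sub_sqrt_le_sqrt_abs_sub (htc0.trans hmtc) hR0).trans
            (Real.sqrt_le_sqrt hmeanMedian)
      _ ≤ √σ * 3 := by linarith
      _ ≤ _ := by
          gcongr
          linarith
  · rw [mul_comm]
    gcongr
    have hpi : (Real.pi / 2) ^ ((1 : ℝ) / 4) ≤ 1.12 := by
      calc (Real.pi / 2) ^ ((1 : ℝ) / 4) ≤ ((1.12 : ℝ) ^ 4) ^ ((1 : ℝ) / 4) := by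
            have := Real.pi_lt_d4
            gcongr
            norm_num
            linarith
        _ = 1.12 := by
            rw [← Real.rpow_natCast, ← Real.rpow_mul (by norm_num)]
            norm_num
    linarith
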